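/- arXiv:2112.13525 — 2 statements merged into one kernel-verified Lean document; each statement's English description precedes it below -/
import Mathlib

section
/- Suppose α + β ∉ ℤ. Then the Vir_B-module V^φ_{α,β,ψ} = V(φ) ⊗ V'_{α,β,ψ} is irreducible if and only if V^φ_{α,β,ψ} is generated by v_φ ⊗ v_m for every m ∈ ℤ (i.e., each v_φ ⊗ v_m is a cyclic vector). -/
open Finsupp TensorProduct

noncomputable section

/-- Loop-Virasoro carrier: `Vir ⊗ B ≅ (⊕_{n∈ℤ} d_n ⊗ B) ⊕ (C ⊗ B)`. -/
abbrev LVir (B : Type*) [AddCommMonoid B] : Type _ := (ℤ →₀ B) × B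

variable (B : Type*) [CommRing B] [Algebra ℂ B]

/-- `[d_m ⊗ a, d_n ⊗ b] = (n-m) d_{m+n} ⊗ ab + δ_{m,-n} ((m³-m)/12) C ⊗ ab`. -/
def ldBracket (m n : ℤ) (a b : B) : LVir B :=
  (Finsupp.single (m + n) ((((n : ℂ) - (m : ℂ))) • (a * b)),
    (if m = -n then ((m : ℂ) ^ 3 - (m : ℂ)) / 12 else 0) • (a * b))

/-- The bracket of the loop-Virasoro algebra `Vir_B = Vir ⊗ B`; `C ⊗ B` is central. -/
def lvirBracket (x y : LVir B) : LVir B :=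
  x.1.sum fun m a => y.1.sum fun n b => ldBracket B m n a b

/-- Action of `d_n` on `V_{α,β}` -/
def dAct (α β : ℂ) (n : ℤ) : Module.End ℂ (ℤ →₀ ℂ) :=
  Finsupp.lsum ℂ fun k => (α + (k : ℂ) + (n : ℂ) * β) • Finsupp.lsingle (k + n)

/-- Action of `Vir_B` on `V_{α,β,ψ}`:  `(d_n ⊗ b) · v_k = ψ(b)(α + k + nβ) v_{k+n}`,
`(C ⊗ b) · v_k = 0`. -/
def lAction (α β : ℂ) (ψ : B →ₐ[ℂ] ℂ) : LVir B →ₗ[ℂ] Module.End ℂ (ℤ →₀ ℂ) :=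
  (Finsupp.lsum ℂ fun n =>
      (LinearMap.toSpanSingleton ℂ (Module.End ℂ (ℤ →₀ ℂ)) (dAct α β n)).comp ψ.toLinearMap).comp
    (LinearMap.fst ℂ (ℤ →₀ B) B)

def ActInvariant {L V : Type*} [AddCommGroup V] [Module ℂ V]
    (act : L → Module.End ℂ V) (U : Submodule ℂ V) : Prop :=
  ∀ x : L, ∀ v ∈ U, act x v ∈ U

def ActIrreducible {L V : Type*} [AddCommGroup V] [Module ℂ V]
    (act : L → Module.End ℂ V) : Prop :=
  ∀ U : Submodule ℂ V, ActInvariant act U → U = ⊥ ∨ U = ⊤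

def ActGenerates {L V : Type*} [AddCommGroup V] [Module ℂ V]
    (act : L → Module.End ℂ V) (S : Set V) : Prop :=
  ∀ U : Submodule ℂ V, ActInvariant act U → S ⊆ U → U = ⊤

/-- Data of the irreducible highest weight `Vir_B`-module `V(φ)` attached to a one-dimensional
representation `φ` of `Vir⁰_B` (given by its values `φd b = φ(d_0 ⊗ b)`, `φC b = φ(C ⊗ b)`),
with highest weight vector `hv = v_φ`. -/
structure HWRep (B : Type*) [CommRing B] [Algebra ℂ B]
    (W : Type*) [AddCommGroup W] [Module ℂ W] where
  ρ : LVir B →ₗ[ℂ] Module.End ℂ W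
  rep : ∀ x y : LVir B, ρ (lvirBracket B x y) = ρ x * ρ y - ρ y * ρ x
  hv : W
  hv_ne : hv ≠ 0
  φd : B →ₗ[ℂ] ℂ
  φC : B →ₗ[ℂ] ℂ
  hw : ∀ n : ℤ, 0 < n → ∀ b : B, ρ (Finsupp.single n b, 0) hv = 0
  wt0 : ∀ b : B, ρ (Finsupp.single 0 b, 0) hv = φd b • hv
  cen : ∀ b : B, ρ (0, b) hv = φC b • hv
  gen : ActGenerates (fun x => ρ x) {hv}
  irr : ActIrreducible (fun x => ρ x)

/-- The tensor product module `V^φ_{α,β,ψ} = V(φ) ⊗ V'_{α,β,ψ}`. -/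
def tensAct {W : Type*} [AddCommGroup W] [Module ℂ W] (D : HWRep B W)
    (α β : ℂ) (ψ : B →ₐ[ℂ] ℂ) (x : LVir B) : Module.End ℂ (W ⊗[ℂ] (ℤ →₀ ℂ)) :=
  TensorProduct.map (D.ρ x) LinearMap.id + TensorProduct.map LinearMap.id (lAction B α β ψ x)

namespace HWRep

variable {B} {W : Type*} [AddCommGroup W] [Module ℂ W]

/-- The vectors of `W` annihilated by `d_n ⊗ b` for all sufficiently large `n`. -/
def smoothPart (D : HWRep B W) : Submodule ℂ W where
  carrier := {w | ∃ N : ℤ, ∀ n ≥ N, ∀ b : B, D.ρ (single n b, 0) w = 0}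
  zero_mem' := ⟨0, fun _ _ _ => map_zero _⟩
  add_mem' := by
    rintro v w ⟨N, hN⟩ ⟨M, hM⟩
    refine ⟨max N M, fun n hn b => ?_⟩
    rw [map_add, hN n (le_of_max_le_left hn), hM n (le_of_max_le_right hn), add_zero]
  smul_mem' := by
    rintro c w ⟨N, hN⟩
    exact ⟨N, fun n hn b => by rw [map_smul, hN n hn, smul_zero]⟩

theorem smoothPart_invariant (D : HWRep B W) :
    ActInvariant (fun x => D.ρ x) D.smoothPart := by
  rintro ⟨f, c⟩ w hw
  obtain ⟨N, hN⟩ := hw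
  have hsplit : ((f, c) : LVir B) = (f, 0) + (0, c) := by simp
  change D.ρ (f, c) w ∈ D.smoothPart
  rw [hsplit, map_add, LinearMap.add_apply]
  refine add_mem ?_ ⟨N, fun n hn b => ?_⟩
  · induction f using Finsupp.induction_linear with
    | zero =>
      rw [show ((0, 0) : LVir B) = 0 from rfl, map_zero]
      exact zero_mem _
    | add f g hf hg =>
      rw [show ((f + g, 0) : LVir B) = (f, 0) + (g, 0) by simp, map_add, LinearMap.add_apply]
      exact add_mem (hf (by simp)) (hg (by simp))
    | single m a =>
      refine ⟨max N (max (N - m) (1 - m)), fun n hn b => ?_⟩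
      have h := congrArg (· w) (D.rep (single n b, 0) (single m a, 0))
      have hne : n ≠ -m := by grind
      simp only [lvirBracket, ldBracket, LinearMap.sub_apply, Module.End.mul_apply] at h
      rw [Finsupp.sum_single_index (by simp), Finsupp.sum_single_index (by simp), if_neg hne,
        zero_smul, hN n (le_of_max_le_left hn), hN (n + m) (by grind), map_zero, sub_zero] at h
      exact h.symm
  · have h := congrArg (· w) (D.rep (single n b, 0) (0, c))
    simp only [lvirBracket, LinearMap.sub_apply, Module.End.mul_apply] at h
    rw [Finsupp.sum_single_index (by simp), Finsupp.sum_zero_index, map_zero, hN n hn, map_zero,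
      sub_zero] at h
    exact h.symm

theorem smoothPart_eq_top (D : HWRep B W) : D.smoothPart = ⊤ :=
  D.gen _ D.smoothPart_invariant
    (Set.singleton_subset_iff.2 ⟨1, fun n hn b => D.hw n (by lia) b⟩)

end HWRep

section ShiftedTensor

variable {B} {W : Type*} [AddCommGroup W] [Module ℂ W]

theorem lAction_single (α β : ℂ) (ψ : B →ₐ[ℂ] ℂ) (n k : ℤ) (b c : B) :
    lAction B α β ψ (single n b, c) (single k 1) =
      (ψ b * (α + k + n * β)) • single (k + n) (1 : ℂ) := by
  simp [lAction, dAct, -Finsupp.single_add, -Finsupp.single_mul, mul_add]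

/-- The map sending `w` at position `k` to `w ⊗ v_{k+n}`. -/
def shiftTensor (W : Type*) [AddCommGroup W] [Module ℂ W] (n : ℤ) :
    (ℤ →₀ W) →ₗ[ℂ] W ⊗[ℂ] (ℤ →₀ ℂ) :=
  Finsupp.lsum ℂ fun k => (TensorProduct.mk ℂ W (ℤ →₀ ℂ)).flip (single (k + n) 1)

theorem shiftTensor_single (n k : ℤ) (w : W) :
    shiftTensor W n (single k w) = w ⊗ₜ single (k + n) 1 := by
  simp [shiftTensor]

theorem shiftTensor_zero_surjective : Function.Surjective (shiftTensor W 0) := by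
  rw [← LinearMap.range_eq_top, eq_top_iff]
  rintro u -
  induction u using TensorProduct.induction_on with
  | zero => exact zero_mem _
  | add u v hu hv => exact add_mem hu hv
  | tmul w g =>
    induction g using Finsupp.induction_linear with
    | zero => simp
    | add g h hg hh => rw [TensorProduct.tmul_add]; exact add_mem hg hh
    | single k c =>
      refine ⟨single k (c • w), ?_⟩
      rw [shiftTensor_single, TensorProduct.smul_tmul]
      simp

/-- The diagonal operator multiplying position `k` by `α + k`. -/
def posMul (W : Type*) [AddCommGroup W] [Module ℂ W] (α : ℂ) : Module.End ℂ (ℤ →₀ W) :=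
  Finsupp.lsum ℂ fun k => (α + (k : ℂ)) • Finsupp.lsingle k

theorem posMul_single (α : ℂ) (k : ℤ) (w : W) :
    posMul W α (single k w) = (α + k) • single k w := by
  simp [posMul]

theorem posMul_apply (α : ℂ) (f : ℤ →₀ W) (k : ℤ) : posMul W α f k = (α + k) • f k := by
  induction f using Finsupp.induction_linear with
  | zero => simp
  | add f g hf hg => simp [hf, hg]
  | single j w =>
    rw [posMul_single, Finsupp.smul_apply]
    rcases eq_or_ne j k with rfl | h
    · rfl
    · simp [h]

/-- For `n` large, `d_n ⊗ 1` acts on a given vector of the tensor product and on all its shifts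
through the second factor only. -/
theorem tensAct_shiftTensor (D : HWRep B W) (α β : ℂ) (ψ : B →ₐ[ℂ] ℂ) (f : ℤ →₀ W) :
    ∃ N : ℤ, ∀ n ≥ N, ∀ m : ℤ, tensAct B D α β ψ (single n 1, 0) (shiftTensor W m f) =
      shiftTensor W (m + n) (posMul W α f) + ((m : ℂ) + n * β) • shiftTensor W (m + n) f := by
  induction f using Finsupp.induction_linear with
  | zero => exact ⟨0, by simp⟩
  | add f g hf hg =>
    obtain ⟨N, hN⟩ := hf
    obtain ⟨M, hM⟩ := hg
    refine ⟨max N M, fun n hn m => ?_⟩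
    simp only [map_add, hN n (le_of_max_le_left hn), hM n (le_of_max_le_right hn)]
    module
  | single k w =>
    obtain ⟨N, hN⟩ : w ∈ D.smoothPart := D.smoothPart_eq_top ▸ Submodule.mem_top
    refine ⟨N, fun n hn m => ?_⟩
    simp only [tensAct, posMul_single, map_smul, shiftTensor_single, LinearMap.add_apply,
      TensorProduct.map_tmul, hN n hn, lAction_single, LinearMap.id_apply, map_one,
      TensorProduct.zero_tmul, TensorProduct.tmul_smul, add_assoc]
    push_cast
    module

/-- The families all of whose sufficiently far shifts lie in `U`. -/
def eventualShifts (U : Submodule ℂ (W ⊗[ℂ] (ℤ →₀ ℂ))) : Submodule ℂ (ℤ →₀ W) where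
  carrier := {f | ∃ N : ℤ, ∀ n ≥ N, shiftTensor W n f ∈ U}
  zero_mem' := ⟨0, by simp⟩
  add_mem' := by
    rintro f g ⟨N, hN⟩ ⟨M, hM⟩
    refine ⟨max N M, fun n hn => ?_⟩
    rw [map_add]
    exact add_mem (hN n (le_of_max_le_left hn)) (hM n (le_of_max_le_right hn))
  smul_mem' := by
    rintro c f ⟨N, hN⟩
    exact ⟨N, fun n hn => by rw [map_smul]; exact U.smul_mem c (hN n hn)⟩

theorem posMul_mem_eventualShifts (D : HWRep B W) {α β : ℂ} {ψ : B →ₐ[ℂ] ℂ}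
    {U : Submodule ℂ (W ⊗[ℂ] (ℤ →₀ ℂ))} (hU : ActInvariant (tensAct B D α β ψ) U)
    {f : ℤ →₀ W} (hf : f ∈ eventualShifts U) : posMul W α f ∈ eventualShifts U := by
  obtain ⟨M, hM⟩ := hf
  obtain ⟨N, hN⟩ := tensAct_shiftTensor D α β ψ f
  refine ⟨max M (M + N), fun s hs => ?_⟩
  have h := hU (single (s - M) 1, 0) _ (hM M le_rfl)
  rw [hN (s - M) (by grind), add_sub_cancel] at h
  exact (U.add_mem_iff_left (U.smul_mem _ (hM s (le_of_max_le_left hs)))).1 h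

/-- A nonzero invariant subspace yields a nonzero family of eventual shifts. -/
theorem eventualShifts_ne_bot (D : HWRep B W) {α β : ℂ} {ψ : B →ₐ[ℂ] ℂ} (hβ : β ≠ 1)
    (hαβ : ∀ z : ℤ, α + β ≠ z) {U : Submodule ℂ (W ⊗[ℂ] (ℤ →₀ ℂ))}
    (hU : ActInvariant (tensAct B D α β ψ) U) (hne : U ≠ ⊥) : eventualShifts U ≠ ⊥ := by
  obtain ⟨u, huU, hu0⟩ := U.ne_bot_iff.1 hne
  obtain ⟨f, rfl⟩ := shiftTensor_zero_surjective u
  have hf0 : f ≠ 0 := by rintro rfl; simp at hu0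
  obtain ⟨N, hN⟩ := tensAct_shiftTensor D α β ψ f
  obtain ⟨M, hM⟩ := tensAct_shiftTensor D α β ψ (posMul W α f)
  refine (Submodule.ne_bot_iff _).2 ?_
  rcases eq_or_ne β 0 with rfl | hβ0
  · refine ⟨posMul W α f, ⟨N, fun n hn => ?_⟩, fun h => ?_⟩
    · have h := hU (single n 1, 0) _ huU
      rw [hN n hn] at h
      simpa using h
    · obtain ⟨k, hk⟩ := Finsupp.ne_iff.1 hf0
      have hk' := DFunLike.congr_fun h k
      rw [posMul_apply, Finsupp.zero_apply, smul_eq_zero] at hk'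
      refine hk'.elim (fun h' => hαβ (-k) ?_) hk
      push_cast
      linear_combination h'
  · refine ⟨f, ⟨max N (max M 0) + max N (max M 0) + 2, fun n hn => ?_⟩, hf0⟩
    set K := max N (max M 0) with hK
    have key : ∀ t : ℤ, K ≤ t → K ≤ n - t →
        shiftTensor W n (posMul W α (posMul W α f)) +
          ((t : ℂ) + ((n : ℂ) - t) * β) • shiftTensor W n (posMul W α f) +
          ((t : ℂ) * β) • (shiftTensor W n (posMul W α f) +
            ((t : ℂ) + ((n : ℂ) - t) * β) • shiftTensor W n f) ∈ U := by
      intro t ht ht'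
      have h := hU (single (n - t) 1, 0) _ (hU (single t 1, 0) _ huU)
      rw [hN t (by grind), map_add, map_smul, hM (n - t) (by grind), hN (n - t) (by grind)] at h
      simpa using h
    have h₀ := key K le_rfl (by lia)
    have h₁ := key (K + 1) (by lia) (by lia)
    have h₂ := key (K + 2) (by lia) (by lia)
    have hc : 2 * β * (1 - β) ≠ 0 :=
      mul_ne_zero (mul_ne_zero two_ne_zero hβ0) (sub_ne_zero.2 hβ.symm)
    refine (U.smul_mem_iff hc).1 ?_
    convert add_mem (sub_mem h₂ (U.smul_mem (2 : ℂ) h₁)) h₀ using 1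
    push_cast
    module

/-- A nonzero subspace stable under the diagonal operator contains a nonzero homogeneous vector. -/
theorem exists_single_mem_of_posMul_invariant {α : ℂ} {G : Submodule ℂ (ℤ →₀ W)}
    (hG : ∀ f ∈ G, posMul W α f ∈ G) (hne : G ≠ ⊥) : ∃ k : ℤ, ∃ w : W, w ≠ 0 ∧ single k w ∈ G := by
  obtain ⟨f, hf, hf0⟩ := G.ne_bot_iff.1 hne
  induction hc : f.support.card using Nat.strong_induction_on generalizing f with
  | _ c ih =>
  obtain ⟨k, hk⟩ := Finsupp.support_nonempty_iff.2 hf0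
  set g := posMul W α f - (α + k) • f with hg
  have hgj : ∀ j, g j = ((j : ℂ) - k) • f j := fun j => by
    rw [hg, Finsupp.sub_apply, posMul_apply, Finsupp.smul_apply]
    module
  have hgG : g ∈ G := sub_mem (hG f hf) (G.smul_mem _ hf)
  rcases eq_or_ne g 0 with h0 | h0
  · refine ⟨k, f k, Finsupp.mem_support_iff.1 hk, ?_⟩
    convert hf
    ext j
    rcases eq_or_ne k j with rfl | hkj
    · simp
    · have h := hgj j
      rw [h0, Finsupp.zero_apply, eq_comm, smul_eq_zero, sub_eq_zero, Int.cast_inj] at h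
      rw [Finsupp.single_eq_of_ne hkj.symm, h.resolve_left hkj.symm]
  · refine ih _ ?_ g hgG h0 rfl
    rw [← hc]
    refine Finset.card_lt_card ((Finset.ssubset_iff_of_subset fun j hj => ?_).2 ⟨k, hk, ?_⟩)
    · rw [Finsupp.mem_support_iff] at hj ⊢
      exact fun h => hj (by rw [hgj, h, smul_zero])
    · simp [hgj]

/-- The vectors `w` with `w ⊗ v_k ∈ U` for all sufficiently large `k`. -/
def eventualPart (U : Submodule ℂ (W ⊗[ℂ] (ℤ →₀ ℂ))) : Submodule ℂ W :=
  (eventualShifts U).comap (Finsupp.lsingle 0)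

theorem mem_eventualPart {U : Submodule ℂ (W ⊗[ℂ] (ℤ →₀ ℂ))} {w : W} :
    w ∈ eventualPart U ↔ ∃ N : ℤ, ∀ k ≥ N, w ⊗ₜ[ℂ] single k (1 : ℂ) ∈ U := by
  change (∃ N : ℤ, ∀ n ≥ N, shiftTensor W n (single 0 w) ∈ U) ↔ _
  simp only [shiftTensor_single, zero_add]

theorem eventually_tmul_lAction_mem (α β : ℂ) (ψ : B →ₐ[ℂ] ℂ)
    {U : Submodule ℂ (W ⊗[ℂ] (ℤ →₀ ℂ))} {w : W} (hw : w ∈ eventualPart U) (x : LVir B) :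
    ∃ N : ℤ, ∀ k ≥ N, w ⊗ₜ[ℂ] lAction B α β ψ x (single k 1) ∈ U := by
  obtain ⟨f, c⟩ := x
  have hc : ∀ g, lAction B α β ψ (g, c) = lAction B α β ψ (g, 0) := fun g => by simp [lAction]
  rw [hc]
  induction f using Finsupp.induction_linear with
  | zero => exact ⟨0, fun k _ => by simp [lAction]⟩
  | add f g hf hg =>
    obtain ⟨N, hN⟩ := hf
    obtain ⟨M, hM⟩ := hg
    refine ⟨max N M, fun k hk => ?_⟩
    rw [show ((f + g, 0) : LVir B) = (f, 0) + (g, 0) by simp, map_add, LinearMap.add_apply,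
      TensorProduct.tmul_add]
    exact add_mem (hN k (le_of_max_le_left hk)) (hM k (le_of_max_le_right hk))
  | single n b =>
    obtain ⟨N, hN⟩ := mem_eventualPart.1 hw
    refine ⟨N - n, fun k hk => ?_⟩
    rw [lAction_single, TensorProduct.tmul_smul]
    exact U.smul_mem _ (hN _ (by lia))

theorem eventualPart_invariant (D : HWRep B W) {α β : ℂ} {ψ : B →ₐ[ℂ] ℂ}
    {U : Submodule ℂ (W ⊗[ℂ] (ℤ →₀ ℂ))} (hU : ActInvariant (tensAct B D α β ψ) U) :
    ActInvariant (fun x => D.ρ x) (eventualPart U) := by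
  intro x w hw
  obtain ⟨N, hN⟩ := mem_eventualPart.1 hw
  obtain ⟨M, hM⟩ := eventually_tmul_lAction_mem α β ψ hw x
  refine mem_eventualPart.2 ⟨max N M, fun k hk => ?_⟩
  have h := hU x _ (hN k (le_of_max_le_left hk))
  simp only [tensAct, LinearMap.add_apply, TensorProduct.map_tmul, LinearMap.id_apply] at h
  exact (U.add_mem_iff_left (hM k (le_of_max_le_right hk))).1 h

/-- Every nonzero invariant subspace contains `v_φ ⊗ v_m` for some `m`. -/
theorem exists_hv_tmul_mem (D : HWRep B W) {α β : ℂ} {ψ : B →ₐ[ℂ] ℂ} (hβ : β ≠ 1)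
    (hαβ : ∀ z : ℤ, α + β ≠ z) {U : Submodule ℂ (W ⊗[ℂ] (ℤ →₀ ℂ))}
    (hU : ActInvariant (tensAct B D α β ψ) U) (hne : U ≠ ⊥) :
    ∃ m : ℤ, D.hv ⊗ₜ[ℂ] single m (1 : ℂ) ∈ U := by
  obtain ⟨k, w, hw0, N, hN⟩ := exists_single_mem_of_posMul_invariant
    (fun f hf => posMul_mem_eventualShifts D hU hf) (eventualShifts_ne_bot D hβ hαβ hU hne)
  have hw : w ∈ eventualPart U := mem_eventualPart.2 ⟨k + N, fun j hj => by
    simpa [shiftTensor_single] using hN (j - k) (by lia)⟩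
  have htop : eventualPart U = ⊤ := (D.irr _ (eventualPart_invariant D hU)).resolve_left
    ((Submodule.ne_bot_iff _).2 ⟨w, hw, hw0⟩)
  obtain ⟨M, hM⟩ := mem_eventualPart.1 (htop ▸ Submodule.mem_top : D.hv ∈ eventualPart U)
  exact ⟨M, hM M le_rfl⟩

theorem tmul_single_one_ne_zero {w : W} (hw : w ≠ 0) (m : ℤ) :
    w ⊗ₜ[ℂ] single m (1 : ℂ) ≠ 0 := by
  intro h
  have h' := congrArg (fun u => TensorProduct.finsuppScalarRight ℂ ℂ W ℤ u m) h
  simp at h'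
  exact hw h'

end ShiftedTensor

/-- For `α + β ∉ ℤ`, the `Vir_B`-module `V^φ_{α,β,ψ} = V(φ) ⊗ V'_{α,β,ψ}` is irreducible
if and only if it is generated by `v_φ ⊗ v_m` for every `m ∈ ℤ`. -/
theorem tensor_irreducible_iff_cyclic {W : Type*} [AddCommGroup W] [Module ℂ W]
    (D : HWRep B W) (α β : ℂ) (hα0 : 0 ≤ α.re) (hα1 : α.re < 1) (hβ : β ≠ 1)
    (hαβ : ∀ z : ℤ, α + β ≠ (z : ℂ))
    (ψ : B →ₐ[ℂ] ℂ) (hirr : ActIrreducible (fun x : LVir B => lAction B α β ψ x)) :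
    ActIrreducible (V := W ⊗[ℂ] (ℤ →₀ ℂ)) (tensAct B D α β ψ) ↔
      ∀ m : ℤ, ActGenerates (V := W ⊗[ℂ] (ℤ →₀ ℂ)) (tensAct B D α β ψ) {D.hv ⊗ₜ[ℂ] Finsupp.single m (1 : ℂ)} := by
  constructor
  · intro h m U hU hm
    have hmU : D.hv ⊗ₜ[ℂ] Finsupp.single m (1 : ℂ) ∈ U := Set.singleton_subset_iff.1 hm
    exact (h U hU).resolve_left
      ((Submodule.ne_bot_iff _).2 ⟨_, hmU, tmul_single_one_ne_zero D.hv_ne m⟩)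
  · intro h U hU
    refine or_iff_not_imp_left.2 fun hne => ?_
    obtain ⟨m, hm⟩ := exists_hv_tmul_mem D hβ hαβ hU hne
    exact h m U hU (Set.singleton_subset_iff.2 hm)
end
end

section
/- V^{φ₁}_{α₁,β₁,ψ₁} ≅ V^{φ₂}_{α₂,β₂,ψ₂} as Vir_B-modules if and only if ψ₁ = ψ₂, φ₁ = φ₂, α₁ = α₂, and β₁ = β₂. -/
open Finsupp TensorProduct

noncomputable section

variable (B : Type*) [CommRing B] [Algebra ℂ B]

section LoopVirasoro

variable {B}
variable {M : Type*} [AddCommGroup M] [Module ℂ M]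

section Representation

variable {ρ : LVir B →ₗ[ℂ] Module.End ℂ M}

/-- The commutation relation of `d_m ⊗ a` and `d_n ⊗ b` in a representation, applied to a vector. -/
lemma rep_d_d (hρ : ∀ x y : LVir B, ρ (lvirBracket B x y) = ρ x * ρ y - ρ y * ρ x)
    (m n : ℤ) (a b : B) (v : M) :
    ρ (single m a, 0) (ρ (single n b, 0) v) =
      ρ (single n b, 0) (ρ (single m a, 0) v) +
        (((n : ℂ) - (m : ℂ)) • ρ (single (m + n) (a * b), 0) v +
          (if m = -n then ((m : ℂ) ^ 3 - (m : ℂ)) / 12 else 0) • ρ (0, a * b) v) := by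
  have hb : lvirBracket B (single m a, 0) (single n b, 0) =
      ((n : ℂ) - (m : ℂ)) • ((single (m + n) (a * b), 0) : LVir B) +
        (if m = -n then ((m : ℂ) ^ 3 - (m : ℂ)) / 12 else 0) • ((0, a * b) : LVir B) := by
    rw [lvirBracket, Finsupp.sum_single_index, Finsupp.sum_single_index]
    · refine Prod.ext ?_ ?_
      · simp only [ldBracket, Prod.fst_add, Prod.smul_fst, smul_zero, add_zero,
          Finsupp.smul_single]
      · simp only [ldBracket, Prod.snd_add, Prod.smul_snd, smul_zero, zero_add]
    · simp [ldBracket]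
    · simp [ldBracket]
  have h := LinearMap.congr_fun (hρ (single m a, 0) (single n b, 0)) v
  rw [hb, map_add, map_smul, map_smul] at h
  simp only [LinearMap.add_apply, LinearMap.smul_apply, LinearMap.sub_apply,
    Module.End.mul_apply] at h
  rw [h]
  abel

lemma rep_c_comm (hρ : ∀ x y : LVir B, ρ (lvirBracket B x y) = ρ x * ρ y - ρ y * ρ x)
    (a : B) (x : LVir B) (v : M) : ρ (0, a) (ρ x v) = ρ x (ρ (0, a) v) := by
  have h := LinearMap.congr_fun (hρ (0, a) x) v
  have hb : lvirBracket B (0, a) x = 0 := by simp [lvirBracket]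
  rw [hb] at h
  rw [map_zero, LinearMap.zero_apply, LinearMap.sub_apply] at h
  exact sub_eq_zero.1 h.symm

/-- A submodule stable under all `d_n ⊗ b` and all `C ⊗ b` is invariant. -/
lemma actInvariant_of_generators {U : Submodule ℂ M}
    (hd : ∀ (n : ℤ) (b : B), ∀ v ∈ U, ρ (single n b, 0) v ∈ U)
    (hc : ∀ b : B, ∀ v ∈ U, ρ (0, b) v ∈ U) : ActInvariant (fun x => ρ x) U := by
  rintro ⟨f, c⟩ v hv
  have hfc : ((f, c) : LVir B) = LinearMap.inl ℂ (ℤ →₀ B) B f + (0, c) := by simp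
  show ρ (f, c) v ∈ U
  rw [hfc, map_add, LinearMap.add_apply]
  refine U.add_mem ?_ (hc c v hv)
  induction f using Finsupp.induction_linear with
  | zero => rw [map_zero, map_zero]; exact U.zero_mem
  | add f g hf hg =>
    rw [map_add, map_add, LinearMap.add_apply]
    exact U.add_mem (hf (by simp)) (hg (by simp))
  | single n b => exact hd n b v hv

/-- `v` is annihilated by `d_n ⊗ B` for `n > 0`, and `d_0 ⊗ B`, `C ⊗ B` act on it by scalars. -/
structure IsHighestWeight (ρ : LVir B →ₗ[ℂ] Module.End ℂ M) (v : M) (χ κ : B → ℂ) : Prop where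
  ann : ∀ n : ℤ, 0 < n → ∀ b : B, ρ (single n b, 0) v = 0
  wt : ∀ b : B, ρ (single 0 b, 0) v = χ b • v
  cen : ∀ b : B, ρ (0, b) v = κ b • v

/-- A highest weight vector lies in an invariant submodule obtained from it by applying only
operators of negative degree. -/
lemma IsHighestWeight.exists_invariant
    (hρ : ∀ x y : LVir B, ρ (lvirBracket B x y) = ρ x * ρ y - ρ y * ρ x)
    {v : M} {χ κ : B → ℂ} (hv : IsHighestWeight ρ v χ κ) :
    ∃ N : Submodule ℂ M, ActInvariant (fun x => ρ x) N ∧ v ∈ N ∧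
      ∀ U : Submodule ℂ M, v ∈ U →
        (∀ m : ℤ, m < 0 → ∀ a : B, ∀ y ∈ U, ρ (single m a, 0) y ∈ U) → N ≤ U := by
  set N : Submodule ℂ M := sInf {U | v ∈ U ∧
    ∀ m : ℤ, m < 0 → ∀ a : B, ∀ y ∈ U, ρ (single m a, 0) y ∈ U}
  have hvN : v ∈ N := Submodule.mem_sInf.2 fun U hU => hU.1
  have hneg : ∀ m : ℤ, m < 0 → ∀ a : B, ∀ y ∈ N, ρ (single m a, 0) y ∈ N :=
    fun m hm a y hy => Submodule.mem_sInf.2 fun U hU =>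
      hU.2 m hm a y (Submodule.mem_sInf.1 hy U hU)
  have hle : ∀ U : Submodule ℂ M, v ∈ U →
      (∀ m : ℤ, m < 0 → ∀ a : B, ∀ y ∈ U, ρ (single m a, 0) y ∈ U) → N ≤ U :=
    fun U h₁ h₂ => sInf_le ⟨h₁, h₂⟩
  let Q : Submodule ℂ M :=
    { carrier := {y | y ∈ N ∧ (∀ (n : ℤ) (b : B), ρ (single n b, 0) y ∈ N) ∧
        ∀ b : B, ρ (0, b) y ∈ N}
      zero_mem' := by simp
      add_mem' := fun {x y} hx hy => by
        refine ⟨N.add_mem hx.1 hy.1, fun n b => ?_, fun b => ?_⟩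
        · rw [map_add]; exact N.add_mem (hx.2.1 n b) (hy.2.1 n b)
        · rw [map_add]; exact N.add_mem (hx.2.2 b) (hy.2.2 b)
      smul_mem' := fun c x hx => by
        refine ⟨N.smul_mem c hx.1, fun n b => ?_, fun b => ?_⟩
        · rw [map_smul]; exact N.smul_mem c (hx.2.1 n b)
        · rw [map_smul]; exact N.smul_mem c (hx.2.2 b) }
  have hNQ : N ≤ Q := by
    refine hle Q ⟨hvN, fun n b => ?_, fun b => ?_⟩ fun m hm a y hy =>
      ⟨hneg m hm a y hy.1, fun n b => ?_, fun b => ?_⟩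
    · rcases lt_trichotomy n 0 with h | rfl | h
      · exact hneg n h b v hvN
      · rw [hv.wt]; exact N.smul_mem _ hvN
      · rw [hv.ann n h]; exact N.zero_mem
    · rw [hv.cen]; exact N.smul_mem _ hvN
    · rw [rep_d_d hρ]
      exact N.add_mem (hneg m hm a _ (hy.2.1 n b))
        (N.add_mem (N.smul_mem _ (hy.2.1 _ _)) (N.smul_mem _ (hy.2.2 _)))
    · rw [rep_c_comm hρ]
      exact hneg m hm a _ (hy.2.2 b)
  exact ⟨N, actInvariant_of_generators (fun n b y hy => (hNQ hy).2.1 n b)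
    (fun b y hy => (hNQ hy).2.2 b), hvN, hle⟩

/-- `d_m ⊗ a` shifts the eigenvalue of `d_0 ⊗ 1` by `m`. -/
lemma rep_d_mem_eigenspace
    (hρ : ∀ x y : LVir B, ρ (lvirBracket B x y) = ρ x * ρ y - ρ y * ρ x)
    (m : ℤ) (a : B) {μ : ℂ} {y : M}
    (hy : y ∈ (ρ (single 0 1, 0)).eigenspace μ) :
    ρ (single m a, 0) y ∈ (ρ (single 0 1, 0)).eigenspace (μ + m) := by
  rw [Module.End.mem_eigenspace_iff] at hy ⊢
  rw [rep_d_d hρ, hy]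
  by_cases hm : m = 0
  · subst hm; simp
  · simp [hm, add_smul, eq_comm]

/-- The invariant submodule generated by a highest weight vector `v` of weight `χ` lies in
`ℂ v` plus the eigenspaces of `d_0 ⊗ 1` for `χ 1 - n`, `n > 0`. -/
lemma IsHighestWeight.exists_invariant_le
    (hρ : ∀ x y : LVir B, ρ (lvirBracket B x y) = ρ x * ρ y - ρ y * ρ x)
    {v : M} {χ κ : B → ℂ} (hv : IsHighestWeight ρ v χ κ) :
    ∃ N : Submodule ℂ M, ActInvariant (fun x => ρ x) N ∧ v ∈ N ∧
      N ≤ Submodule.span ℂ {v} ⊔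
        ⨆ n : ℕ, (ρ (single 0 1, 0)).eigenspace (χ 1 - (n + 1)) := by
  obtain ⟨N, hinv, hvN, hle⟩ := hv.exists_invariant hρ
  refine ⟨N, hinv, hvN, hle _ (Submodule.mem_sup_left (Submodule.mem_span_singleton_self v)) ?_⟩
  intro m hm a y hy
  obtain ⟨k, rfl⟩ : ∃ k : ℕ, m = -((k : ℤ) + 1) := ⟨(-m - 1).toNat, by omega⟩
  refine Submodule.mem_sup_right ?_
  rw [← Submodule.mem_comap]
  revert y
  rw [← SetLike.le_def]
  refine sup_le ?_ (iSup_le fun n => ?_)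
  · rw [Submodule.span_singleton_le_iff_mem, Submodule.mem_comap]
    refine Submodule.mem_iSup_of_mem k ?_
    have h := rep_d_mem_eigenspace hρ (-((k : ℤ) + 1)) a
      (Module.End.mem_eigenspace_iff.2 (hv.wt 1))
    convert h using 2
    push_cast; ring
  · intro y hy
    refine Submodule.mem_iSup_of_mem (n + k + 1) ?_
    have h := rep_d_mem_eigenspace hρ (-((k : ℤ) + 1)) a hy
    convert h using 2
    push_cast; ring

lemma eigenspace_inf_iSup_eq_zero {f : Module.End ℂ M} {μ : ℂ} {g : ℕ → ℂ}
    (hg : ∀ n, g n ≠ μ) {y : M} (hy : y ∈ f.eigenspace μ)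
    (hy' : y ∈ ⨆ n, f.eigenspace (g n)) : y = 0 := by
  have h := (Module.End.eigenspaces_iSupIndep f) μ
  refine Submodule.disjoint_def.1 h y hy ?_
  refine (iSup_le fun n => ?_ : (⨆ n, f.eigenspace (g n)) ≤ _) hy'
  exact le_iSup₂_of_le (g n) (hg n) le_rfl

/-- The weight-`μ` vectors in `ℂ v ⊕ ⨁_{n > 0} M_{μ - n}` are the multiples of `v`. -/
lemma mem_span_of_mem_eigenspace {f : Module.End ℂ M} {μ : ℂ} {v y : M}
    (hv : v ∈ f.eigenspace μ) (hy : y ∈ f.eigenspace μ)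
    (h : y ∈ Submodule.span ℂ {v} ⊔ ⨆ n : ℕ, f.eigenspace (μ - (n + 1))) :
    y ∈ Submodule.span ℂ {v} := by
  obtain ⟨z, hz, t, ht, rfl⟩ := Submodule.mem_sup.1 h
  have hz' : z ∈ f.eigenspace μ := (Submodule.span_singleton_le_iff_mem _ _).2 hv hz
  have ht' : t = 0 := by
    refine eigenspace_inf_iSup_eq_zero (fun n hn => ?_)
      ((Submodule.add_mem_iff_right _ hz').1 hy) ht
    have : ((n + 1 : ℕ) : ℂ) = 0 := by push_cast; linear_combination -hn
    exact Nat.succ_ne_zero n (by exact_mod_cast this)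
  simpa [ht'] using hz

lemma exists_eq_sub_natCast {f : Module.End ℂ M} {μ ν : ℂ} {v y : M} (hy0 : y ≠ 0)
    (hv : v ∈ f.eigenspace ν) (hy : y ∈ f.eigenspace μ)
    (h : y ∈ Submodule.span ℂ {v} ⊔ ⨆ n : ℕ, f.eigenspace (ν - (n + 1))) :
    ∃ n : ℕ, μ = ν - n := by
  by_contra! hne
  refine hy0 (eigenspace_inf_iSup_eq_zero (g := fun n : ℕ => ν - n) (fun n => (hne n).symm) hy ?_)
  refine (sup_le ?_ (iSup_le fun n => ?_) : _ ≤ ⨆ n : ℕ, f.eigenspace (ν - n)) h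
  · rw [Submodule.span_singleton_le_iff_mem]
    exact Submodule.mem_iSup_of_mem 0 (by simpa using hv)
  · exact le_iSup_of_le (n + 1) (by push_cast; exact le_rfl)

end Representation

namespace HWRep

variable {W W₁ W₂ : Type*} [AddCommGroup W] [Module ℂ W] [AddCommGroup W₁] [Module ℂ W₁]
  [AddCommGroup W₂] [Module ℂ W₂]

lemma isHighestWeight (D : HWRep B W) : IsHighestWeight D.ρ D.hv D.φd D.φC :=
  ⟨D.hw, D.wt0, D.cen⟩

/-- Highest weight vectors of an irreducible highest weight module are unique up to scalars. -/
lemma mem_span_hv (D : HWRep B W) {w : W} (hw0 : w ≠ 0) {χ κ : B → ℂ}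
    (hw : IsHighestWeight D.ρ w χ κ) : w ∈ Submodule.span ℂ {D.hv} := by
  have key : ∀ {u : W} {χ' κ' : B → ℂ}, u ≠ 0 → IsHighestWeight D.ρ u χ' κ' → ∀ y : W,
      y ∈ Submodule.span ℂ {u} ⊔
        ⨆ n : ℕ, (D.ρ (single 0 1, 0)).eigenspace (χ' 1 - (n + 1)) := by
    intro u χ' κ' hu0 hu y
    obtain ⟨N, hinv, huN, hle⟩ := hu.exists_invariant_le D.rep
    refine hle ?_
    rcases D.irr N hinv with rfl | rfl
    · exact absurd huN hu0
    · exact Submodule.mem_top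
  have hw1 := Module.End.mem_eigenspace_iff.2 (hw.wt 1)
  have hv1 := Module.End.mem_eigenspace_iff.2 (D.wt0 1)
  obtain ⟨n, hn⟩ := exists_eq_sub_natCast D.hv_ne hw1 hv1 (key hw0 hw D.hv)
  obtain ⟨m, hm⟩ := exists_eq_sub_natCast hw0 hv1 hw1 (key D.hv_ne D.isHighestWeight w)
  have hnm : ((n + m : ℕ) : ℂ) = 0 := by push_cast; linear_combination hn + hm
  have hm0 : m = 0 := by
    have : n + m = 0 := by exact_mod_cast hnm
    omega
  subst hm0
  rw [hm, Nat.cast_zero, sub_zero] at hw1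
  exact mem_span_of_mem_eigenspace hv1 hw1 (key D.hv_ne D.isHighestWeight w)

/-- A nonzero highest weight vector determines the highest weight. -/
lemma weight_eq (D : HWRep B W) {w : W} (hw0 : w ≠ 0) {χ κ : B → ℂ}
    (hw : IsHighestWeight D.ρ w χ κ) (b : B) : χ b = D.φd b ∧ κ b = D.φC b := by
  obtain ⟨c, rfl⟩ := Submodule.mem_span_singleton.1 (D.mem_span_hv hw0 hw)
  refine ⟨smul_left_injective ℂ hw0 ?_, smul_left_injective ℂ hw0 ?_⟩
  · show χ b • c • D.hv = D.φd b • c • D.hv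
    rw [← hw.wt, map_smul, D.wt0, smul_comm]
  · show κ b • c • D.hv = D.φC b • c • D.hv
    rw [← hw.cen, map_smul, D.cen, smul_comm]

/-- Operators of sufficiently large degree annihilate a given vector. -/
lemma exists_bound (D : HWRep B W) (w : W) :
    ∃ N : ℕ, ∀ n : ℤ, N < n → ∀ b : B, D.ρ (single n b, 0) w = 0 := by
  let U : Submodule ℂ W :=
    { carrier := {w | ∃ N : ℕ, ∀ n : ℤ, N < n → ∀ b : B, D.ρ (single n b, 0) w = 0}
      zero_mem' := ⟨0, by simp⟩
      add_mem' := by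
        rintro x y ⟨N, hN⟩ ⟨N', hN'⟩
        exact ⟨N + N', fun n hn b => by
          rw [map_add, hN n (by omega), hN' n (by omega), add_zero]⟩
      smul_mem' := by
        rintro c x ⟨N, hN⟩
        exact ⟨N, fun n hn b => by rw [map_smul, hN n hn, smul_zero]⟩ }
  have hU : U = ⊤ := by
    refine D.gen U (actInvariant_of_generators ?_ ?_) ?_
    · rintro m a v ⟨N, hN⟩
      refine ⟨N + m.natAbs, fun n hn b => ?_⟩
      rw [rep_d_d D.rep, hN n (by omega), hN (n + m) (by omega), if_neg (by omega)]
      simp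
    · rintro a v ⟨N, hN⟩
      exact ⟨N, fun n hn b => by rw [← rep_c_comm D.rep, hN n hn, map_zero]⟩
    · rw [Set.singleton_subset_iff]
      exact ⟨0, fun n hn => D.hw n (by omega)⟩
  exact (hU ▸ Submodule.mem_top : w ∈ U)

/-- The direct sum of two highest weight representations. -/
def prodRep (D₁ : HWRep B W₁) (D₂ : HWRep B W₂) : LVir B →ₗ[ℂ] Module.End ℂ (W₁ × W₂) where
  toFun x := (D₁.ρ x).prodMap (D₂.ρ x)
  map_add' x y := by ext <;> simp
  map_smul' c x := by ext <;> simp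

@[simp]
lemma prodRep_apply (D₁ : HWRep B W₁) (D₂ : HWRep B W₂) (x : LVir B) (w : W₁ × W₂) :
    prodRep D₁ D₂ x w = (D₁.ρ x w.1, D₂.ρ x w.2) := rfl

/-- Irreducible highest weight modules with the same highest weight are isomorphic. -/
lemma exists_equiv (D₁ : HWRep B W₁) (D₂ : HWRep B W₂) (hd : D₁.φd = D₂.φd)
    (hc : D₁.φC = D₂.φC) :
    ∃ e : W₁ ≃ₗ[ℂ] W₂, ∀ (x : LVir B) (w : W₁), e (D₁.ρ x w) = D₂.ρ x (e w) := by
  have hrep : ∀ x y : LVir B, prodRep D₁ D₂ (lvirBracket B x y) =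
      prodRep D₁ D₂ x * prodRep D₁ D₂ y - prodRep D₁ D₂ y * prodRep D₁ D₂ x := by
    intro x y
    refine LinearMap.ext fun w => ?_
    simp [D₁.rep, D₂.rep]
  have hhw : IsHighestWeight (prodRep D₁ D₂) (D₁.hv, D₂.hv) D₁.φd D₁.φC :=
    ⟨fun n hn b => by simp [D₁.hw n hn, D₂.hw n hn], fun b => by simp [D₁.wt0, D₂.wt0, hd],
      fun b => by simp [D₁.cen, D₂.cen, hc]⟩
  obtain ⟨N, hinv, hvN, hle⟩ := hhw.exists_invariant_le hrep
  have hker : ∀ y : W₂, ((0, y) : W₁ × W₂) ∈ N → y = 0 := by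
    have hK : ActInvariant (fun x => D₂.ρ x) (N.comap (LinearMap.inr ℂ W₁ W₂)) := by
      intro x y hy
      simpa using hinv x _ hy
    rcases D₂.irr _ hK with h | h
    · intro y hy
      have : y ∈ N.comap (LinearMap.inr ℂ W₁ W₂) := hy
      simpa [h] using this
    · exfalso
      have h0 : D₂.hv ∈ N.comap (LinearMap.inr ℂ W₁ W₂) := h ▸ Submodule.mem_top
      have hmem := mem_span_of_mem_eigenspace (Module.End.mem_eigenspace_iff.2 (hhw.wt 1))
        (y := ((0, D₂.hv) : W₁ × W₂))
        (Module.End.mem_eigenspace_iff.2 (by simp [D₂.wt0, hd])) (hle h0)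
      obtain ⟨c, hc'⟩ := Submodule.mem_span_singleton.1 hmem
      obtain ⟨h1, h2⟩ := Prod.ext_iff.1 hc'
      have hc0 : c = 0 := by simpa [D₁.hv_ne] using h1
      exact D₂.hv_ne (by simpa [hc0] using h2.symm)
  have hsurj : N.map (LinearMap.fst ℂ W₁ W₂) = ⊤ := by
    refine D₁.gen _ ?_ (Set.singleton_subset_iff.2 ⟨_, hvN, rfl⟩)
    rintro x _ ⟨w, hw, rfl⟩
    exact ⟨_, hinv x w hw, rfl⟩
  have hbij : Function.Bijective ((LinearMap.fst ℂ W₁ W₂).comp N.subtype) := by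
    constructor
    · rw [← LinearMap.ker_eq_bot, LinearMap.ker_eq_bot']
      rintro ⟨⟨a, b⟩, hab⟩ h
      obtain rfl : a = 0 := h
      obtain rfl := hker b hab
      rfl
    · intro a
      obtain ⟨w, hw, rfl⟩ : a ∈ N.map (LinearMap.fst ℂ W₁ W₂) := hsurj ▸ Submodule.mem_top
      exact ⟨⟨w, hw⟩, rfl⟩
  let p := LinearEquiv.ofBijective _ hbij
  let f : W₁ →ₗ[ℂ] W₂ := (LinearMap.snd ℂ W₁ W₂).comp (N.subtype.comp p.symm.toLinearMap)
  have hf : ∀ w : W₁ × W₂, w ∈ N → f w.1 = w.2 := by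
    intro w hw
    have : p.symm w.1 = ⟨w, hw⟩ := by
      rw [LinearEquiv.symm_apply_eq]; rfl
    simp [f, this]
  have hfN : ∀ a : W₁, (a, f a) ∈ N := by
    intro a
    obtain ⟨w, hw, rfl⟩ : a ∈ N.map (LinearMap.fst ℂ W₁ W₂) := hsurj ▸ Submodule.mem_top
    rw [LinearMap.fst_apply, hf w hw]
    exact hw
  have hfx : ∀ (x : LVir B) (a : W₁), f (D₁.ρ x a) = D₂.ρ x (f a) :=
    fun x a => hf _ (hinv x _ (hfN a))
  have hfhv : f D₁.hv = D₂.hv := hf _ hvN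
  have hfbij : Function.Bijective f := by
    constructor
    · rw [← LinearMap.ker_eq_bot]
      have hK : ActInvariant (fun x => D₁.ρ x) (LinearMap.ker f) := by
        intro x a ha
        rw [LinearMap.mem_ker] at ha ⊢
        rw [hfx, ha, map_zero]
      refine (D₁.irr _ hK).resolve_right fun h => D₂.hv_ne ?_
      rw [← hfhv, ← LinearMap.mem_ker, h]
      exact Submodule.mem_top
    · rw [← LinearMap.range_eq_top]
      refine D₂.gen _ ?_ (Set.singleton_subset_iff.2 ⟨_, hfhv⟩)
      rintro x _ ⟨a, rfl⟩
      exact ⟨_, hfx x a⟩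
  exact ⟨LinearEquiv.ofBijective f hfbij, hfx⟩

end HWRep

section Scalars

lemma lAction_d (α β : ℂ) (ψ : B →ₐ[ℂ] ℂ) (n : ℤ) (b : B) (k : ℤ) (c : ℂ) :
    lAction B α β ψ (single n b, 0) (single k c) =
      single (k + n) (ψ b * ((α + k + n * β) * c)) := by
  simp [lAction, dAct, -Finsupp.single_mul, -Finsupp.single_add, Finsupp.smul_single]

lemma lAction_c (α β : ℂ) (ψ : B →ₐ[ℂ] ℂ) (b : B) : lAction B α β ψ (0, b) = 0 := by
  simp [lAction]

/-- An irreducible `V_{α,β,ψ}` with `β = 0` has no invariant vector. -/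
lemma ActIrreducible.add_intCast_ne_zero {α β : ℂ} {ψ : B →ₐ[ℂ] ℂ}
    (h : ActIrreducible (fun x : LVir B => lAction B α β ψ x)) (hβ : β = 0) (k : ℤ) :
    α + k ≠ 0 := by
  intro hk
  have hinv : ActInvariant (fun x : LVir B => lAction B α β ψ x)
      (Submodule.span ℂ {single k (1 : ℂ)}) := by
    refine actInvariant_of_generators (fun n b v hv => ?_) (fun b v hv => ?_)
    · obtain ⟨c, rfl⟩ := Submodule.mem_span_singleton.1 hv
      simp [lAction_d, hβ, hk]
    · simp [lAction_c]
  rcases h _ hinv with h | h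
  · simp at h
  · have hmem : single (k + 1) (1 : ℂ) ∈ Submodule.span ℂ {single k (1 : ℂ)} :=
      h ▸ Submodule.mem_top
    obtain ⟨c, hc⟩ := Submodule.mem_span_singleton.1 hmem
    simpa using DFunLike.congr_fun hc (k + 1)

lemma exists_add_mul_ne_zero {a c β : ℂ} (h : β = 0 → a ≠ 0 ∧ c ≠ 0) (N : ℕ) :
    ∃ n : ℕ, N < n ∧ a + n * β ≠ 0 ∧ c + n * β ≠ 0 := by
  by_cases hβ : β = 0
  · exact ⟨N + 1, by omega, by simpa [hβ] using h hβ⟩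
  by_contra! hne
  have h1 := hne (N + 1) (by omega)
  have h2 := hne (N + 2) (by omega)
  have h3 := hne (N + 3) (by omega)
  push_cast at h1 h2 h3
  apply hβ
  by_cases e1 : a + (N + 1) * β = 0
  · have e2 : a + (N + 2) * β ≠ 0 := fun e2 => hβ (by linear_combination e2 - e1)
    have e3 : a + (N + 3) * β ≠ 0 := fun e3 => hβ (by linear_combination (e3 - e1) / 2)
    linear_combination h3 e3 - h2 e2
  · by_cases e2 : a + (N + 2) * β = 0
    · have e3 : a + (N + 3) * β ≠ 0 := fun e3 => hβ (by linear_combination e3 - e2)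
      linear_combination (h3 e3 - h1 e1) / 2
    · linear_combination h2 e2 - h1 e1

lemma polynomial_eq_zero_of_natCast {P : Polynomial ℂ} {N : ℕ}
    (h : ∀ n : ℕ, N < n → P.eval (n : ℂ) = 0) : P = 0 := by
  refine Polynomial.eq_zero_of_infinite_isRoot P ?_
  refine Set.Infinite.mono ?_ ((Set.Ioi_infinite N).image Nat.cast_injective.injOn)
  rintro _ ⟨n, hn, rfl⟩
  exact h n hn

open Polynomial in
/-- The relation between the structure constants that forces two intermediate series to agree. -/
lemma parameters_eq {a c β₁ β₂ : ℂ} {N : ℕ} (h₁ : β₁ = 0 → a ≠ 0) (h₂ : β₂ = 0 → c ≠ 0)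
    (hβ₁ : β₁ ≠ 1) (hβ₂ : β₂ ≠ 1)
    (h : ∀ p m : ℕ, N < p → N < m →
      (a + (p + m) * β₁) * ((c + p * β₂) * (c + p + m * β₂)) =
        ((a + p * β₁) * (a + p + m * β₁)) * (c + (p + m) * β₂)) : a = c ∧ β₁ = β₂ := by
  have hx : ∀ (x : ℂ) (m : ℕ), N < m →
      (a + (x + m) * β₁) * ((c + x * β₂) * (c + x + m * β₂)) =
        ((a + x * β₁) * (a + x + m * β₁)) * (c + (x + m) * β₂) := by
    intro x m hm
    have := polynomial_eq_zero_of_natCast (N := N)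
      (P := (C a + (X + C (m : ℂ)) * C β₁) * ((C c + X * C β₂) * (C c + X + C (m * β₂))) -
        ((C a + X * C β₁) * (C a + X + C (m * β₁))) * (C c + (X + C (m : ℂ)) * C β₂))
      (fun p hp => by
        simp only [eval_sub, eval_mul, eval_add, eval_C, eval_X]
        rw [sub_eq_zero]; exact h p m hp hm)
    have := congrArg (eval x) this
    simp only [eval_sub, eval_mul, eval_add, eval_C, eval_X, eval_zero] at this
    exact sub_eq_zero.1 this
  have hxy : ∀ x y : ℂ,
      (a + (x + y) * β₁) * ((c + x * β₂) * (c + x + y * β₂)) =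
        ((a + x * β₁) * (a + x + y * β₁)) * (c + (x + y) * β₂) := by
    intro x y
    have := polynomial_eq_zero_of_natCast (N := N)
      (P := (C a + (C x + X) * C β₁) * (C (c + x * β₂) * (C (c + x) + X * C β₂)) -
        (C (a + x * β₁) * (C (a + x) + X * C β₁)) * (C c + (C x + X) * C β₂))
      (fun m hm => by
        simp only [eval_sub, eval_mul, eval_add, eval_C, eval_X]
        rw [sub_eq_zero]; exact hx x m hm)
    have := congrArg (eval y) this
    simp only [eval_sub, eval_mul, eval_add, eval_C, eval_X, eval_zero] at this
    exact sub_eq_zero.1 this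
  clear hx h
  by_cases hb₁ : β₁ = 0 <;> by_cases hb₂ : β₂ = 0
  · have ha := h₁ hb₁
    have hc := h₂ hb₂
    subst hb₁ hb₂
    refine ⟨mul_left_cancel₀ (mul_ne_zero ha hc) ?_, rfl⟩
    linear_combination -hxy 0 0
  · have ha := h₁ hb₁
    subst hb₁
    have e : ∀ x, c + x * β₂ = a + x := fun x =>
      mul_left_cancel₀ (mul_ne_zero ha hb₂) (by linear_combination hxy x 1 - hxy x 0)
    exact absurd (by linear_combination e 1 - e 0) hβ₂
  · have hc := h₂ hb₂
    subst hb₂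
    have e : ∀ x, a + x * β₁ = c + x := fun x =>
      mul_left_cancel₀ (mul_ne_zero hc hb₁) (by linear_combination hxy x 0 - hxy x 1)
    exact absurd (by linear_combination e 1 - e 0) hβ₁
  · obtain ⟨t, rfl⟩ : ∃ t, a = t * β₁ := ⟨a / β₁, by field_simp⟩
    have e : ∀ y : ℂ, (c - t * β₂) * y * (c - t + y * β₂) = 0 := fun y =>
      mul_left_cancel₀ hb₁ (by linear_combination hxy (-t) y)
    obtain rfl : c = t * β₂ := by
      refine mul_left_cancel₀ hb₂ ?_
      linear_combination (e 2 - 2 * e 1) / 2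
    have e' : ∀ y : ℂ, y + 1 ≠ 0 →
        t * β₂ + (1 - t) + y * β₂ = t * β₁ + (1 - t) + y * β₁ := fun y hy =>
      mul_left_cancel₀ (mul_ne_zero (mul_ne_zero hb₁ hb₂) hy)
        (by linear_combination hxy (1 - t) y)
    have e0 := e' 0 (by norm_num)
    have e1 := e' 1 (by norm_num)
    exact ⟨by linear_combination -e0, by linear_combination e0 - e1⟩

lemma eq_of_add_intCast_eq {α₁ α₂ : ℂ} {k i : ℤ} (hα₁0 : 0 ≤ α₁.re) (hα₁1 : α₁.re < 1)
    (hα₂0 : 0 ≤ α₂.re) (hα₂1 : α₂.re < 1) (h : α₁ + k = α₂ + i) : α₁ = α₂ ∧ k = i := by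
  have hre : α₁.re + k = α₂.re + i := by simpa using congrArg Complex.re h
  have h1 : k < i + 1 := by
    have : (k : ℝ) < (i + 1 : ℤ) := by push_cast; linarith
    exact_mod_cast this
  have h2 : i < k + 1 := by
    have : (i : ℝ) < (k + 1 : ℤ) := by push_cast; linarith
    exact_mod_cast this
  obtain rfl : k = i := by omega
  exact ⟨add_right_cancel h, rfl⟩

end Scalars

section Tensor

variable {W : Type*} [AddCommGroup W] [Module ℂ W]

/-- The `W`-valued coordinate of index `i` of an element of `W ⊗ (⊕_{i ∈ ℤ} ℂ v_i)`. -/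
def tensCoord (i : ℤ) : W ⊗[ℂ] (ℤ →₀ ℂ) →ₗ[ℂ] W :=
  (Finsupp.lapply i).comp (TensorProduct.finsuppScalarRight ℂ ℂ W ℤ).toLinearMap

@[simp]
lemma tensCoord_tmul (i : ℤ) (w : W) (f : ℤ →₀ ℂ) : tensCoord i (w ⊗ₜ[ℂ] f) = f i • w := by
  simp [tensCoord]

lemma tens_ext {u v : W ⊗[ℂ] (ℤ →₀ ℂ)} (h : ∀ i, tensCoord i u = tensCoord i v) : u = v :=
  (TensorProduct.finsuppScalarRight ℂ ℂ W ℤ).injective (Finsupp.ext h)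

lemma tensCoord_tensAct_d (D : HWRep B W) (α β : ℂ) (ψ : B →ₐ[ℂ] ℂ) (n : ℤ) (b : B) (i : ℤ)
    (u : W ⊗[ℂ] (ℤ →₀ ℂ)) :
    tensCoord (i + n) (tensAct B D α β ψ (single n b, 0) u) =
      D.ρ (single n b, 0) (tensCoord (i + n) u) +
        (ψ b * (α + i + n * β)) • tensCoord i u := by
  induction u using TensorProduct.induction_on with
  | zero => simp
  | add x y hx hy => simp only [map_add, hx, hy, smul_add]; abel
  | tmul w f =>
    induction f using Finsupp.induction_linear with
    | zero => simp
    | add f g hf hg => simp only [TensorProduct.tmul_add, map_add, hf, hg, smul_add]; abel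
    | single k c =>
      by_cases hk : k = i
      · subst hk
        simp [tensAct, lAction_d, smul_smul, mul_assoc]
      · simp only [tensAct, LinearMap.add_apply, TensorProduct.map_tmul, LinearMap.id_apply,
          lAction_d, map_add, tensCoord_tmul, Finsupp.single_apply, hk, add_left_inj, if_false,
          zero_smul, smul_zero, map_smul]

lemma tensAct_c_tmul (D : HWRep B W) (α β : ℂ) (ψ : B →ₐ[ℂ] ℂ) (b : B) (w : W) (f : ℤ →₀ ℂ) :
    tensAct B D α β ψ (0, b) (w ⊗ₜ f) = D.ρ (0, b) w ⊗ₜ f := by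
  simp [tensAct, lAction_c]

lemma tensAct_d_tmul (D : HWRep B W) (α β : ℂ) (ψ : B →ₐ[ℂ] ℂ) (n : ℤ) (b : B) (w : W) (k : ℤ) :
    tensAct B D α β ψ (single n b, 0) (w ⊗ₜ single k 1) =
      D.ρ (single n b, 0) w ⊗ₜ single k 1 +
        (ψ b * (α + k + n * β)) • (w ⊗ₜ single (k + n) 1) := by
  simp [tensAct, lAction_d, ← TensorProduct.tmul_smul]

lemma tensAct_d_hv (D : HWRep B W) (α β : ℂ) (ψ : B →ₐ[ℂ] ℂ) {n : ℤ} (hn : 0 < n) (b : B)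
    (k : ℤ) :
    tensAct B D α β ψ (single n b, 0) (D.hv ⊗ₜ single k 1) =
      (ψ b * (α + k + n * β)) • (D.hv ⊗ₜ single (k + n) 1) := by
  rw [tensAct_d_tmul, D.hw n hn, TensorProduct.zero_tmul, zero_add]

lemma exists_bound_tensCoord (D : HWRep B W) (u : W ⊗[ℂ] (ℤ →₀ ℂ)) :
    ∃ N : ℕ, ∀ n : ℤ, N < n → ∀ (b : B) (i : ℤ), D.ρ (single n b, 0) (tensCoord i u) = 0 := by
  induction u using TensorProduct.induction_on with
  | zero => exact ⟨0, by simp⟩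
  | add x y hx hy =>
    obtain ⟨N, hN⟩ := hx
    obtain ⟨N', hN'⟩ := hy
    exact ⟨N + N', fun n hn b i => by
      rw [map_add, map_add, hN n (by omega), hN' n (by omega), add_zero]⟩
  | tmul w f =>
    obtain ⟨N, hN⟩ := D.exists_bound w
    exact ⟨N, fun n hn b i => by rw [tensCoord_tmul, map_smul, hN n hn, smul_zero]⟩

variable {W₁ W₂ : Type*} [AddCommGroup W₁] [Module ℂ W₁] [AddCommGroup W₂] [Module ℂ W₂]
  {D₁ : HWRep B W₁} {D₂ : HWRep B W₂} {α α₁ β β₁ α₂ β₂ : ℂ} {ψ ψ₁ ψ₂ : B →ₐ[ℂ] ℂ}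
  {T : W₁ ⊗[ℂ] (ℤ →₀ ℂ) →ₗ[ℂ] W₂ ⊗[ℂ] (ℤ →₀ ℂ)}

lemma psi_eq_of_tensCoord_ne_zero
    (hT : ∀ x v, T (tensAct B D₁ α₁ β₁ ψ₁ x v) = tensAct B D₂ α₂ β₂ ψ₂ x (T v))
    (hirr₂ : ActIrreducible (fun x : LVir B => lAction B α₂ β₂ ψ₂ x)) {k i : ℤ}
    (hi : tensCoord i (T (D₁.hv ⊗ₜ single k 1)) ≠ 0) : ψ₁ = ψ₂ := by
  ext b
  set u := T (D₁.hv ⊗ₜ single k 1) with hu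
  obtain ⟨N, hN⟩ := exists_bound_tensCoord D₂ u
  obtain ⟨n, hn, hne, -⟩ := exists_add_mul_ne_zero (a := α₂ + i) (c := α₂ + i) (β := β₂)
    (fun h => ⟨hirr₂.add_intCast_ne_zero h i, hirr₂.add_intCast_ne_zero h i⟩) N
  have hL : tensAct B D₁ α₁ β₁ ψ₁ (single (n : ℤ) b, 0) (D₁.hv ⊗ₜ single k 1) =
      ψ₁ b • tensAct B D₁ α₁ β₁ ψ₁ (single (n : ℤ) 1, 0) (D₁.hv ⊗ₜ single k 1) := by
    rw [tensAct_d_hv _ _ _ _ (by omega), tensAct_d_hv _ _ _ _ (by omega), smul_smul, map_one,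
      one_mul]
  have h := congrArg (fun z => tensCoord (i + n) (T z)) hL
  simp only [map_smul, hT, tensCoord_tensAct_d] at h
  rw [← hu, hN n (by omega), hN n (by omega), zero_add, zero_add, smul_smul, map_one, one_mul] at h
  have := smul_left_injective ℂ hi h
  exact (mul_right_cancel₀ (by simpa using hne) this).symm

lemma parameters_eq_of_tensCoord_ne_zero
    (hT : ∀ x v, T (tensAct B D₁ α₁ β₁ ψ₁ x v) = tensAct B D₂ α₂ β₂ ψ₂ x (T v))
    (hβ₁ : β₁ ≠ 1) (hβ₂ : β₂ ≠ 1)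
    (hirr₁ : ActIrreducible (fun x : LVir B => lAction B α₁ β₁ ψ₁ x))
    (hirr₂ : ActIrreducible (fun x : LVir B => lAction B α₂ β₂ ψ₂ x)) {k i : ℤ}
    (hi : tensCoord i (T (D₁.hv ⊗ₜ single k 1)) ≠ 0) : α₁ + k = α₂ + i ∧ β₁ = β₂ := by
  set u := T (D₁.hv ⊗ₜ single k 1) with hu
  obtain ⟨N, hN⟩ := exists_bound_tensCoord D₂ u
  refine parameters_eq (N := N) (fun h => hirr₁.add_intCast_ne_zero h k)
    (fun h => hirr₂.add_intCast_ne_zero h i) hβ₁ hβ₂ fun p m hp hm => ?_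
  have hL : (α₁ + k + (p + m) * β₁) • tensAct B D₁ α₁ β₁ ψ₁ (single (m : ℤ) 1, 0)
        (tensAct B D₁ α₁ β₁ ψ₁ (single (p : ℤ) 1, 0) (D₁.hv ⊗ₜ single k 1)) =
      ((α₁ + k + p * β₁) * (α₁ + k + p + m * β₁)) •
        tensAct B D₁ α₁ β₁ ψ₁ (single ((p : ℤ) + m) 1, 0) (D₁.hv ⊗ₜ single k 1) := by
    rw [tensAct_d_hv _ _ _ _ (by omega), map_smul, tensAct_d_hv _ _ _ _ (by omega),
      tensAct_d_hv _ _ _ _ (by omega), smul_smul, smul_smul, smul_smul, add_assoc k]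
    congr 1
    push_cast
    simp only [map_one]
    ring
  have h := congrArg (fun z => tensCoord (i + p + m) (T z)) hL
  simp only [map_smul, hT, tensCoord_tensAct_d] at h
  rw [← hu] at h
  have e1 : tensCoord (i + p + m) (tensAct B D₂ α₂ β₂ ψ₂ (single (p : ℤ) 1, 0) u) =
      (α₂ + (i + m : ℤ) + p * β₂) • tensCoord (i + m) u := by
    rw [add_right_comm, tensCoord_tensAct_d, hN p (by omega)]
    simp
  have e2 : tensCoord (i + p + m) (tensAct B D₂ α₂ β₂ ψ₂ (single ((p : ℤ) + m) 1, 0) u) =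
      (α₂ + i + (p + m) * β₂) • tensCoord i u := by
    rw [add_assoc, tensCoord_tensAct_d, hN _ (by omega)]
    simp
  rw [e1, e2, map_smul, hN m (by omega), hN p (by omega)] at h
  simp only [smul_zero, zero_add, smul_smul, map_one, one_mul] at h
  have := smul_left_injective ℂ hi h
  push_cast at this
  linear_combination this

/-- The `v_k`-coordinate of `T (v_φ ⊗ v_k)` does not depend on `k`. -/
lemma tensCoord_self_eq
    (hT : ∀ x v, T (tensAct B D₁ α β ψ x v) = tensAct B D₂ α β ψ x (T v))
    (hirr : ActIrreducible (fun x : LVir B => lAction B α β ψ x)) (k l : ℤ) :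
    tensCoord k (T (D₁.hv ⊗ₜ single k 1)) = tensCoord l (T (D₁.hv ⊗ₜ single l 1)) := by
  have key : ∀ j : ℤ, ∃ N : ℕ, ∀ n : ℤ, N < n → α + j + n * β ≠ 0 →
      tensCoord j (T (D₁.hv ⊗ₜ single j 1)) =
        tensCoord (j + n) (T (D₁.hv ⊗ₜ single (j + n) 1)) := by
    intro j
    obtain ⟨N, hN⟩ := exists_bound_tensCoord D₂ (T (D₁.hv ⊗ₜ single j 1))
    refine ⟨N, fun n hn hne => ?_⟩
    have h := congrArg (fun z => tensCoord (j + n) (T z))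
      (tensAct_d_hv D₁ α β ψ (n := n) (by omega) 1 j)
    simp only [map_smul, hT, tensCoord_tensAct_d] at h
    rw [hN n hn, zero_add, map_one, one_mul] at h
    exact smul_right_injective W₂ hne h
  obtain ⟨N, hN⟩ := key k
  obtain ⟨N', hN'⟩ := key l
  obtain ⟨n, hn, h1, h2⟩ := exists_add_mul_ne_zero (a := α + k) (c := α + l + (k - l) * β) (β := β)
    (fun h => ⟨hirr.add_intCast_ne_zero h k, by
      simpa [h] using hirr.add_intCast_ne_zero h l⟩) (N + N' + (k - l).natAbs)
  rw [hN n (by omega) (by simpa using h1), hN' (k + n - l) (by omega) (by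
    push_cast
    convert h2 using 1
    ring)]
  rw [add_sub_cancel]

lemma isHighestWeight_of_map_tmul
    (hT : ∀ x v, T (tensAct B D₁ α β ψ x v) = tensAct B D₂ α β ψ x (T v)) {w : W₂}
    (hw : ∀ k : ℤ, T (D₁.hv ⊗ₜ single k 1) = w ⊗ₜ single k 1) :
    IsHighestWeight D₂.ρ w D₁.φd D₁.φC := by
  refine ⟨fun n hn b => ?_, fun b => ?_, fun b => ?_⟩
  · have h := hT (single n b, 0) (D₁.hv ⊗ₜ single 0 1)
    rw [tensAct_d_hv _ _ _ _ hn, map_smul, hw, hw, tensAct_d_tmul, right_eq_add] at h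
    simpa using congrArg (tensCoord 0) h
  · have h := hT (single 0 b, 0) (D₁.hv ⊗ₜ single 0 1)
    rw [tensAct_d_tmul, map_add, map_smul, D₁.wt0, ← TensorProduct.smul_tmul', map_smul, hw, hw,
      tensAct_d_tmul, add_left_inj] at h
    simpa using (congrArg (tensCoord 0) h).symm
  · have h := hT (0, b) (D₁.hv ⊗ₜ single 0 1)
    rw [tensAct_c_tmul, D₁.cen, ← TensorProduct.smul_tmul', map_smul, hw, tensAct_c_tmul] at h
    simpa using (congrArg (tensCoord 0) h).symm

end Tensor

end LoopVirasoro

/-- `V^{φ₁}_{α₁,β₁,ψ₁} ≅ V^{φ₂}_{α₂,β₂,ψ₂}` as `Vir_B`-modules if and only if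
`ψ₁ = ψ₂`, `φ₁ = φ₂` (both on `d_0 ⊗ B` and on `C ⊗ B`), `α₁ = α₂` and `β₁ = β₂`. -/
theorem iso_iff_data_eq {W₁ W₂ : Type*} [AddCommGroup W₁] [Module ℂ W₁]
    [AddCommGroup W₂] [Module ℂ W₂]
    (D₁ : HWRep B W₁) (D₂ : HWRep B W₂) (α₁ β₁ α₂ β₂ : ℂ)
    (hα₁0 : 0 ≤ α₁.re) (hα₁1 : α₁.re < 1) (hβ₁ : β₁ ≠ 1)
    (hα₂0 : 0 ≤ α₂.re) (hα₂1 : α₂.re < 1) (hβ₂ : β₂ ≠ 1)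
    (ψ₁ ψ₂ : B →ₐ[ℂ] ℂ)
    (hirr₁ : ActIrreducible (fun x : LVir B => lAction B α₁ β₁ ψ₁ x))
    (hirr₂ : ActIrreducible (fun x : LVir B => lAction B α₂ β₂ ψ₂ x)) :
    (∃ T : W₁ ⊗[ℂ] (ℤ →₀ ℂ) ≃ₗ[ℂ] W₂ ⊗[ℂ] (ℤ →₀ ℂ),
      ∀ (x : LVir B) (v : W₁ ⊗[ℂ] (ℤ →₀ ℂ)),
        T (tensAct B D₁ α₁ β₁ ψ₁ x v) = tensAct B D₂ α₂ β₂ ψ₂ x (T v)) ↔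
      (ψ₁ = ψ₂ ∧ D₁.φd = D₂.φd ∧ D₁.φC = D₂.φC ∧ α₁ = α₂ ∧ β₁ = β₂) := by
  constructor
  · rintro ⟨T, hT⟩
    have hT' : ∀ x v, T.toLinearMap (tensAct B D₁ α₁ β₁ ψ₁ x v) =
        tensAct B D₂ α₂ β₂ ψ₂ x (T.toLinearMap v) := hT
    have hne : ∀ k : ℤ, ∃ i, tensCoord i (T.toLinearMap (D₁.hv ⊗ₜ single k 1)) ≠ 0 := by
      intro k
      by_contra! h
      have h0 : T (D₁.hv ⊗ₜ single k 1) = 0 := tens_ext fun i => by simpa using h i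
      rw [LinearEquiv.map_eq_zero_iff] at h0
      exact D₁.hv_ne (by simpa using congrArg (tensCoord k) h0)
    have hpar : ∀ k i : ℤ, tensCoord i (T.toLinearMap (D₁.hv ⊗ₜ single k 1)) ≠ 0 →
        (α₁ = α₂ ∧ k = i) ∧ β₁ = β₂ := by
      intro k i hi
      obtain ⟨h, hβ⟩ := parameters_eq_of_tensCoord_ne_zero hT' hβ₁ hβ₂ hirr₁ hirr₂ hi
      exact ⟨eq_of_add_intCast_eq hα₁0 hα₁1 hα₂0 hα₂1 h, hβ⟩
    obtain ⟨i, hi⟩ := hne 0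
    obtain rfl := psi_eq_of_tensCoord_ne_zero hT' hirr₂ hi
    obtain ⟨⟨rfl, rfl⟩, rfl⟩ := hpar 0 i hi
    have hw : ∀ k : ℤ, T.toLinearMap (D₁.hv ⊗ₜ single k 1) =
        tensCoord 0 (T.toLinearMap (D₁.hv ⊗ₜ single 0 1)) ⊗ₜ single k 1 := by
      intro k
      refine tens_ext fun j => ?_
      by_cases hj : k = j
      · subst hj
        rw [tensCoord_tmul, single_eq_same, one_smul]
        exact tensCoord_self_eq hT' hirr₁ k 0
      · rw [tensCoord_tmul, single_eq_of_ne (Ne.symm hj), zero_smul]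
        by_contra h
        exact hj (hpar k j h).1.2
    have hφ := D₂.weight_eq hi (isHighestWeight_of_map_tmul hT' hw)
    exact ⟨rfl, LinearMap.ext fun b => (hφ b).1, LinearMap.ext fun b => (hφ b).2, rfl, rfl⟩
  · rintro ⟨rfl, hd, hc, rfl, rfl⟩
    obtain ⟨e, he⟩ := D₁.exists_equiv D₂ hd hc
    refine ⟨TensorProduct.congr e (LinearEquiv.refl ℂ _), fun x v => ?_⟩
    induction v using TensorProduct.induction_on with
    | zero => simp
    | add v w hv hw => simp only [map_add, hv, hw]
    | tmul w f => simp [tensAct, he]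
end
end
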